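/- arXiv:2509.18346 — 5 statements merged into one kernel-verified Lean document; each statement's English description precedes it below -/
import Mathlib

section
/- Let f : ℝⁿ → ℝ be twice continuously differentiable, β > 0, α > 0. Suppose (x₁, x₂) : ℝ → ℝⁿ × ℝⁿ is differentiable and solves the controlled system x₁'(t) = x₂(t), x₂'(t) = -β ∇²f(x₁(t)) x₂(t) - α (x₂(t) + β ∇f(x₁(t))). Then the off-manifold coordinate M(t) := x₂(t) + β ∇f(x₁(t)) satisfies M'(t) = -α M(t) for all t, and hence M(t) = e^{-α t} M(0); in particular ‖M(t)‖ = e^{-α t} ‖M(0)‖ decays exponentially, so the trajectory converges exponentially to the manifold M₀. -/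
/-- For the closed-loop P&I system
`x₁' = x₂`, `x₂' = -β ∇²f(x₁) x₂ - α (x₂ + β ∇f(x₁))`,
the off-manifold coordinate `M(t) = x₂(t) + β ∇f(x₁(t))` satisfies
`M'(t) = -α M(t)`, hence `M(t) = e^{-α t} M(0)` and
`‖M(t)‖ = e^{-α t} ‖M(0)‖`: the trajectory converges exponentially to `M₀`. -/
theorem off_manifold_coordinate_decays {n : ℕ}
    (f : EuclideanSpace ℝ (Fin n) → ℝ) (hf : ContDiff ℝ 2 f)
    (β α : ℝ) (hβ : 0 < β) (hα : 0 < α)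
    (x₁ x₂ : ℝ → EuclideanSpace ℝ (Fin n))
    (hx₁ : Differentiable ℝ x₁) (hx₂ : Differentiable ℝ x₂)
    (h1 : ∀ t : ℝ, deriv x₁ t = x₂ t)
    (h2 : ∀ t : ℝ, deriv x₂ t
        = -β • (fderiv ℝ (gradient f) (x₁ t)) (x₂ t)
          - α • (x₂ t + β • gradient f (x₁ t))) :
    (∀ t : ℝ, deriv (fun s => x₂ s + β • gradient f (x₁ s)) t
        = -α • (x₂ t + β • gradient f (x₁ t))) ∧
    (∀ t : ℝ, x₂ t + β • gradient f (x₁ t)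
        = Real.exp (-α * t) • (x₂ 0 + β • gradient f (x₁ 0))) ∧
    (∀ t : ℝ, ‖x₂ t + β • gradient f (x₁ t)‖
        = Real.exp (-α * t) * ‖x₂ 0 + β • gradient f (x₁ 0)‖) := by
  have hg : Differentiable ℝ (gradient f) := by
    have h : ContDiff ℝ 1 (fderiv ℝ f) := hf.fderiv_right (by norm_num)
    have h' : Differentiable ℝ (fderiv ℝ f) := h.differentiable (by norm_num)
    exact (InnerProductSpace.toDual ℝ
      (EuclideanSpace ℝ (Fin n))).symm.toContinuousLinearEquiv.differentiable.comp h'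
  have hM : ∀ t : ℝ, HasDerivAt (fun s => x₂ s + β • gradient f (x₁ s))
      (-α • (x₂ t + β • gradient f (x₁ t))) t := by
    intro t
    have a := (hx₂ t).hasDerivAt
    have b := (hx₁ t).hasDerivAt
    rw [h2] at a
    rw [h1] at b
    have c := a.add (((hg (x₁ t)).hasFDerivAt.comp_hasDerivAt t b).const_smul β)
    refine c.congr_deriv ?_
    module
  have hE : ∀ t : ℝ, x₂ t + β • gradient f (x₁ t)
        = Real.exp (-α * t) • (x₂ 0 + β • gradient f (x₁ 0)) := by
    have hN : ∀ t : ℝ, HasDerivAt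
        (fun s => Real.exp (α * s) • (x₂ s + β • gradient f (x₁ s))) 0 t := by
      intro t
      have e : HasDerivAt (fun s : ℝ => Real.exp (α * s)) (Real.exp (α * t) * (α * 1)) t :=
        ((hasDerivAt_id t).const_mul α).exp
      refine (e.smul (hM t)).congr_deriv ?_
      module
    intro t
    have k := is_const_of_deriv_eq_zero (fun t => (hN t).differentiableAt)
      (fun t => (hN t).deriv) t 0
    simp only [mul_zero, Real.exp_zero, one_smul] at k
    rw [← k, smul_smul, ← Real.exp_add]
    simp
  refine ⟨fun t => (hM t).deriv, hE, fun t => ?_⟩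
  rw [hE t, norm_smul, Real.norm_eq_abs, Real.abs_exp]
end

section
/- Let f : E → ℝ be differentiable and μ-strongly convex with μ > 0, let x* be its minimizer, and let L > 0. If x : [0, ∞) → E is differentiable and satisfies the gradient flow x'(t) = -(1/L) ∇f(x(t)) for all t ≥ 0, then for all t ≥ 0, f(x(t)) - f(x*) ≤ (f(x(0)) - f(x*)) · e^{-(μ/L) t}. -/
open scoped RealInnerProductSpace

/-- If `f` is differentiable, `μ`-strongly convex with minimizer `x*`,
and `x` solves the gradient flow `x'(t) = -(1/L) ∇f(x(t))` for `t ≥ 0`, then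
`f(x(t)) - f(x*) ≤ (f(x(0)) - f(x*)) e^{-(μ/L) t}` for all `t ≥ 0`. -/
theorem gradient_flow_exponential_convergence
    {E : Type*} [NormedAddCommGroup E] [InnerProductSpace ℝ E] [FiniteDimensional ℝ E]
    (f : E → ℝ) (hf : Differentiable ℝ f)
    (μ L : ℝ) (hμ : 0 < μ) (hL : 0 < L)
    (hsc : ∀ x y : E, f y ≥ f x + ⟪gradient f x, y - x⟫ + μ / 2 * ‖y - x‖ ^ 2)
    (xstar : E) (hmin : ∀ y : E, f xstar ≤ f y)
    (x : ℝ → E) (hx : Differentiable ℝ x)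
    (hflow : ∀ t : ℝ, 0 ≤ t → deriv x t = -(1 / L) • gradient f (x t)) :
    ∀ t : ℝ, 0 ≤ t →
      f (x t) - f xstar ≤ (f (x 0) - f xstar) * Real.exp (-(μ / L) * t) := by
  have hPL : ∀ z : E, μ * (f z - f xstar) ≤ ‖gradient f z‖ ^ 2 := by
    intro z
    have h1 := hsc z xstar
    have h2 := hmin z
    have h3 := norm_add_sq_real (gradient f z) (μ • (xstar - z))
    rw [inner_smul_right, norm_smul, Real.norm_of_nonneg hμ.le, mul_pow] at h3
    have h4 := sq_nonneg ‖gradient f z + μ • (xstar - z)‖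
    have h5 := mul_le_mul_of_nonneg_left h1 hμ.le
    have h6 : 0 ≤ μ * (f z - f xstar) := mul_nonneg hμ.le (by linarith)
    nlinarith
  have hder : ∀ t : ℝ, 0 ≤ t →
      HasDerivAt (fun s => (f (x s) - f xstar) * Real.exp (μ / L * s))
        ((-(1 / L) * ‖gradient f (x t)‖ ^ 2) * Real.exp (μ / L * t)
          + (f (x t) - f xstar) * (Real.exp (μ / L * t) * (μ / L))) t := by
    intro t ht
    have hg : HasDerivAt (fun s => f (x s)) (-(1 / L) * ‖gradient f (x t)‖ ^ 2) t := by
      have h := ((hf (x t)).hasGradientAt.hasFDerivAt).comp_hasDerivAt t (hx t).hasDerivAt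
      rw [hflow t ht] at h
      rw [InnerProductSpace.toDual_apply_apply, inner_smul_right, real_inner_self_eq_norm_sq] at h
      exact h
    have he : HasDerivAt (fun s : ℝ => Real.exp (μ / L * s))
        (Real.exp (μ / L * t) * (μ / L)) t := by
      simpa using ((hasDerivAt_id t).const_mul (μ / L)).exp
    exact (hg.sub_const _).mul he
  have hanti : AntitoneOn (fun s => (f (x s) - f xstar) * Real.exp (μ / L * s))
      (Set.Ici 0) := by
    apply antitoneOn_of_deriv_nonpos (convex_Ici 0)
    · intro t ht
      exact (hder t ht).continuousAt.continuousWithinAt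
    · intro t ht
      exact (hder t (interior_subset ht)).differentiableAt.differentiableWithinAt
    · intro t ht
      rw [(hder t (interior_subset ht)).deriv]
      have h : 0 ≤ (1 / L * Real.exp (μ / L * t)) *
          (‖gradient f (x t)‖ ^ 2 - μ * (f (x t) - f xstar)) :=
        mul_nonneg (by positivity) (by linarith [hPL (x t)])
      have e : (-(1 / L) * ‖gradient f (x t)‖ ^ 2) * Real.exp (μ / L * t)
          + (f (x t) - f xstar) * (Real.exp (μ / L * t) * (μ / L))
          = -((1 / L * Real.exp (μ / L * t)) *
          (‖gradient f (x t)‖ ^ 2 - μ * (f (x t) - f xstar))) := by ring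
      linarith
  intro t ht
  have h := hanti (Set.mem_Ici.2 le_rfl) (Set.mem_Ici.2 ht) ht
  simp only [mul_zero, Real.exp_zero, mul_one] at h
  have h2 := mul_le_mul_of_nonneg_right h (Real.exp_pos (-(μ / L) * t)).le
  rwa [mul_assoc, ← Real.exp_add, show μ / L * t + -(μ / L) * t = 0 by ring,
    Real.exp_zero, mul_one] at h2
end

section
/- Let f : E → ℝ be convex and differentiable with ∇f L-Lipschitz, and let 0 < μ ≤ L with α := √(μ/L) ∈ (0, 1]. Let x_k, v_k ∈ E, φ_k* ∈ ℝ satisfy φ_k* ≥ f(x_k). Set y_k := (α v_k + x_k)/(1 + α), x_{k+1} := y_k - (1/L) ∇f(y_k), and φ_{k+1}* := (1 - α) φ_k* + α f(y_k) - (α²/(2μ)) ‖∇f(y_k)‖² + α (1 - α) ( ⟨∇f(y_k), v_k - y_k⟩ + (μ/2) ‖v_k - y_k‖² ). Then φ_{k+1}* ≥ f(x_{k+1}). -/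
open scoped RealInnerProductSpace

theorem aux_line {E : Type*} [NormedAddCommGroup E] [InnerProductSpace ℝ E] [CompleteSpace E]
    (f : E → ℝ) (hdiff : Differentiable ℝ f) (y d : E) (t : ℝ) :
    HasDerivAt (fun t : ℝ => f (y + t • d)) (⟪gradient f (y + t • d), d⟫) t := by
  have h1 := (hdiff (y + t • d)).hasGradientAt.hasFDerivAt
  have h2 : HasDerivAt (fun t : ℝ => y + t • d) d t := by
    simpa using ((hasDerivAt_id t).smul_const d).const_add y
  have h3 := h1.comp_hasDerivAt t h2
  exact h3

theorem aux_convex {E : Type*} [NormedAddCommGroup E] [InnerProductSpace ℝ E] [CompleteSpace E]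
    (f : E → ℝ) (hconv : ConvexOn ℝ Set.univ f) (hdiff : Differentiable ℝ f) (y x : E) :
    f y + ⟪gradient f y, x - y⟫ ≤ f x := by
  have hc : ConvexOn ℝ Set.univ (fun t : ℝ => f (y + t • (x - y))) := by
    refine ⟨convex_univ, fun a _ b _ p q hp hq hpq => ?_⟩
    have h := hconv.2 (Set.mem_univ (y + a • (x - y))) (Set.mem_univ (y + b • (x - y))) hp hq hpq
    have e : p • (y + a • (x - y)) + q • (y + b • (x - y))
        = y + (p • a + q • b) • (x - y) := by
      have : q = 1 - p := by linarith
      subst this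
      simp only [smul_eq_mul]
      module
    rw [e] at h
    exact h
  have h0 := aux_line f hdiff y (x - y) 0
  have := hc.le_slope_of_hasDerivAt (Set.mem_univ 0) (Set.mem_univ 1) zero_lt_one h0
  simp only [slope_def_field, zero_smul, add_zero, one_smul, add_sub_cancel, sub_zero, div_one] at this
  linarith

theorem aux_descent {E : Type*} [NormedAddCommGroup E] [InnerProductSpace ℝ E] [CompleteSpace E]
    (f : E → ℝ) (hdiff : Differentiable ℝ f) (L : ℝ) (hL : 0 < L)
    (hlip : LipschitzWith (Real.toNNReal L) (gradient f)) (y d : E) :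
    f (y + d) ≤ f y + ⟪gradient f y, d⟫ + L / 2 * ‖d‖ ^ 2 := by
  have hd : ∀ t : ℝ, HasDerivAt
      (fun t : ℝ => f (y + t • d) - t * ⟪gradient f y, d⟫ - t ^ 2 * (L / 2 * ‖d‖ ^ 2))
      (⟪gradient f (y + t • d), d⟫ - 1 * ⟪gradient f y, d⟫
        - (2 * t) * (L / 2 * ‖d‖ ^ 2)) t := fun t => by
    have h2 : HasDerivAt (fun t : ℝ => t ^ 2) (2 * t) t := by simpa using hasDerivAt_pow 2 t
    exact ((aux_line f hdiff y d t).sub ((hasDerivAt_id t).mul_const _)).sub (h2.mul_const _)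
  have ha := antitoneOn_of_deriv_nonpos (convex_Icc (0 : ℝ) 1)
    (fun t _ => (hd t).continuousAt.continuousWithinAt)
    (fun t _ => (hd t).differentiableAt.differentiableWithinAt)
    (fun t ht => by
      rw [(hd t).deriv]
      rw [interior_Icc] at ht
      have h1 : ⟪gradient f (y + t • d) - gradient f y, d⟫ ≤ L * (t * ‖d‖) * ‖d‖ := by
        refine (real_inner_le_norm _ _).trans ?_
        gcongr
        have := hlip.dist_le_mul (y + t • d) y
        rw [dist_eq_norm, dist_eq_norm, Real.coe_toNNReal _ hL.le] at this
        simpa [norm_smul, abs_of_pos ht.1] using this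
      rw [inner_sub_left] at h1
      nlinarith)
  have := ha (Set.left_mem_Icc.2 zero_le_one) (Set.right_mem_Icc.2 zero_le_one) zero_le_one
  simp only [zero_smul, add_zero, one_smul, zero_mul, one_mul, sub_zero, one_pow, ne_eq, OfNat.ofNat_ne_zero, not_false_eq_true, zero_pow] at this
  linarith

/-- Nesterov's key inequality. For convex `f` with `L`-Lipschitz
gradient, `0 < μ ≤ L`, `α = √(μ/L)`, if `φ_k* ≥ f(x_k)` and
`y_k = (α v_k + x_k)/(1+α)`, `x_{k+1} = y_k - (1/L)∇f(y_k)`,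
`φ_{k+1}* = (1-α)φ_k* + α f(y_k) - (α²/(2μ))‖∇f(y_k)‖²
            + α(1-α)(⟨∇f(y_k), v_k - y_k⟩ + (μ/2)‖v_k - y_k‖²)`,
then `φ_{k+1}* ≥ f(x_{k+1})`. -/
theorem nesterov_key_inequality
    {E : Type*} [NormedAddCommGroup E] [InnerProductSpace ℝ E] [FiniteDimensional ℝ E]
    (f : E → ℝ) (hconv : ConvexOn ℝ Set.univ f) (hdiff : Differentiable ℝ f)
    (μ L : ℝ) (hμ : 0 < μ) (hμL : μ ≤ L)
    (hlip : LipschitzWith (Real.toNNReal L) (gradient f))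
    (α : ℝ) (hα : α = Real.sqrt (μ / L))
    (xk vk yk xk1 : E) (φk : ℝ) (hφk : φk ≥ f xk)
    (hyk : yk = (1 + α)⁻¹ • (α • vk + xk))
    (hxk1 : xk1 = yk - (1 / L) • gradient f yk)
    (φk1 : ℝ)
    (hφk1 : φk1 = (1 - α) * φk + α * f yk - α ^ 2 / (2 * μ) * ‖gradient f yk‖ ^ 2
        + α * (1 - α) * (⟪gradient f yk, vk - yk⟫ + μ / 2 * ‖vk - yk‖ ^ 2)) :
    φk1 ≥ f xk1 := by
  have hL : 0 < L := hμ.trans_le hμL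
  have hα0 : 0 < α := hα ▸ Real.sqrt_pos.2 (div_pos hμ hL)
  have hα1 : α ≤ 1 := by
    rw [hα, Real.sqrt_le_iff, one_pow, div_le_one hL]; exact ⟨zero_le_one, hμL⟩
  have hα2 : α ^ 2 = μ / L := by rw [hα, Real.sq_sqrt (div_pos hμ hL).le]
  have hc : α ^ 2 / (2 * μ) = 1 / (2 * L) := by rw [hα2]; field_simp
  have hxy : xk - yk = -(α • (vk - yk)) := by
    have : (1 + α) • yk = α • vk + xk := by
      rw [hyk, smul_inv_smul₀ (by positivity)]
    have hx : xk = (1 + α) • yk - α • vk := by rw [this]; abel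
    rw [hx]; module
  have h1 := aux_convex f hconv hdiff yk xk
  rw [hxy, inner_neg_right, inner_smul_right] at h1
  have h2 := aux_descent f hdiff L hL hlip yk (-((1 / L) • gradient f yk))
  rw [← sub_eq_add_neg, ← hxk1, inner_neg_right, inner_smul_right, real_inner_self_eq_norm_sq,
    norm_neg, norm_smul, Real.norm_of_nonneg (by positivity)] at h2
  have h3 : f xk1 ≤ f yk - 1 / (2 * L) * ‖gradient f yk‖ ^ 2 := by
    refine h2.trans (le_of_eq ?_)
    field_simp
    ring
  have h4 : 0 ≤ α * (1 - α) * (μ / 2 * ‖vk - yk‖ ^ 2) :=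
    mul_nonneg (mul_nonneg hα0.le (by linarith)) (by positivity)
  have h5 := mul_le_mul_of_nonneg_left (h1.trans hφk) (sub_nonneg.2 hα1)
  rw [hφk1, hc]
  linarith
end

section
/- Let f : E → ℝ be differentiable, μ-strongly convex with μ > 0, with ∇f L-Lipschitz and 0 < μ ≤ L, and let x* be its minimizer. Define iterates by y₀ = x₀ and, for k ≥ 0, x_{k+1} = y_k - (1/L) ∇f(y_k), y_{k+1} = x_{k+1} + β (x_{k+1} - x_k), where β = (√L - √μ)/(√L + √μ). Then for every k ≥ 0, f(x_k) - f(x*) ≤ ( f(x₀) - f(x*) + (μ/2) ‖x₀ - x*‖² ) · (1 - √(μ/L))^k. In particular Nesterov's method converges at the accelerated rate O((1 - 1/√κ)^k) with κ = L/μ. -/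
open scoped RealInnerProductSpace

lemma na_descent {E : Type*} [NormedAddCommGroup E] [InnerProductSpace ℝ E]
    [FiniteDimensional ℝ E] (f : E → ℝ) (hdiff : Differentiable ℝ f) (L : ℝ) (hL : 0 < L)
    (hlip : LipschitzWith (Real.toNNReal L) (gradient f)) (u d : E) :
    f (u + d) ≤ f u + ⟪gradient f u, d⟫ + L / 2 * ‖d‖ ^ 2 := by
  have hder : ∀ t : ℝ, HasDerivAt
      (fun t : ℝ => f (u + t • d) - t * ⟪gradient f u, d⟫ - L / 2 * ‖d‖ ^ 2 * t ^ 2)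
      (⟪gradient f (u + t • d), d⟫ - 1 * ⟪gradient f u, d⟫
        - L / 2 * ‖d‖ ^ 2 * (2 * t)) t := by
    intro t
    have h1 : HasDerivAt (fun t : ℝ => u + t • d) d t := by
      simpa using ((hasDerivAt_id t).smul_const d).const_add u
    have h2 := (hdiff (u + t • d)).hasGradientAt.hasFDerivAt.comp_hasDerivAt t h1
    have h3 := (hasDerivAt_pow 2 t).const_mul (L / 2 * ‖d‖ ^ 2)
    have h4 := (hasDerivAt_id t).mul_const ⟪gradient f u, d⟫
    simp only [InnerProductSpace.toDual_apply_apply] at h2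
    have h5 := (h2.sub h4).sub h3
    simp only [Nat.cast_ofNat, Nat.add_one_sub_one, pow_one] at h5
    exact h5
  have hanti := antitoneOn_of_deriv_nonpos (convex_Ici (0 : ℝ))
    (fun t _ => (hder t).continuousAt.continuousWithinAt)
    (fun t _ => (hder t).differentiableAt.differentiableWithinAt)
    (by
      intro t ht
      rw [interior_Ici] at ht
      have ht0 : 0 < t := ht
      rw [(hder t).deriv]
      have h1 := hlip.norm_sub_le (u + t • d) u
      rw [add_sub_cancel_left, norm_smul, Real.norm_of_nonneg ht0.le,
        Real.coe_toNNReal L hL.le] at h1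
      have h2 := real_inner_le_norm (gradient f (u + t • d) - gradient f u) d
      rw [inner_sub_left] at h2
      have h3 := mul_le_mul_of_nonneg_right h1 (norm_nonneg d)
      nlinarith)
  have := hanti (Set.mem_Ici.2 le_rfl) (Set.mem_Ici.2 zero_le_one) zero_le_one
  simp only [one_smul, zero_smul, add_zero] at this
  linarith

lemma na_algebra {E : Type*} [NormedAddCommGroup E] [InnerProductSpace ℝ E]
    (μ L q : ℝ) (hμ : 0 < μ) (hL : 0 < L) (hq : 0 < q) (hq1 : q ≤ 1) (hqL : q ^ 2 * L = μ)
    (b s g : E) (Fx Fp Fy Fs : ℝ)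
    (h1 : Fp ≤ Fy - 1 / (2 * L) * ‖g‖ ^ 2)
    (h2 : Fs ≥ Fy - ⟪g, b⟫ + μ / 2 * ‖b‖ ^ 2)
    (h3 : Fx ≥ Fy - q * ⟪g, s⟫) :
    Fp - Fs + μ / 2 * ‖b + (1 - q) • s - (q / μ) • g‖ ^ 2
      ≤ (1 - q) * (Fx - Fs + μ / 2 * ‖b + s‖ ^ 2) := by
  have e1 : ‖b + (1 - q) • s - (q / μ) • g‖ ^ 2 = ‖b‖ ^ 2 + (1 - q) ^ 2 * ‖s‖ ^ 2
      + (q / μ) ^ 2 * ‖g‖ ^ 2 + 2 * (1 - q) * ⟪b, s⟫ - 2 * (q / μ) * ⟪g, b⟫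
      - 2 * (q / μ) * (1 - q) * ⟪g, s⟫ := by
    rw [norm_sub_sq_real, norm_add_sq_real, inner_add_left, inner_smul_left, inner_smul_right,
      inner_smul_right, inner_smul_right, norm_smul, norm_smul, mul_pow, mul_pow,
      Real.norm_eq_abs, Real.norm_eq_abs, sq_abs, sq_abs, real_inner_comm g b,
      real_inner_comm g s]
    simp
    ring
  have e2 : μ / 2 * (q / μ) ^ 2 = 1 / (2 * L) := by
    rw [← hqL]; field_simp
  have e3 : μ / 2 * (2 * (q / μ)) = q := by field_simp
  have e4 : μ / 2 * ‖b + (1 - q) • s - (q / μ) • g‖ ^ 2 = μ / 2 * (‖b‖ ^ 2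
      + (1 - q) ^ 2 * ‖s‖ ^ 2 + 2 * (1 - q) * ⟪b, s⟫) + 1 / (2 * L) * ‖g‖ ^ 2
      - q * ⟪g, b⟫ - q * (1 - q) * ⟪g, s⟫ := by
    rw [e1]
    linear_combination ‖g‖ ^ 2 * e2 - (⟪g, b⟫ + (1 - q) * ⟪g, s⟫) * e3
  rw [e4, norm_add_sq_real]
  have k2 := mul_le_mul_of_nonneg_left h2 hq.le
  have k3 := mul_le_mul_of_nonneg_left h3 (sub_nonneg.2 hq1)
  have k4 : 0 ≤ μ / 2 * (q * (1 - q)) * ‖s‖ ^ 2 := by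
    have := sub_nonneg.2 hq1
    positivity
  nlinarith

/-- Nesterov's accelerated method for `μ`-strongly convex,
`L`-smooth `f` (`x_{k+1} = y_k - (1/L)∇f(y_k)`,
`y_{k+1} = x_{k+1} + β(x_{k+1} - x_k)`, `β = (√L-√μ)/(√L+√μ)`, `y₀ = x₀`)
satisfies `f(x_k) - f(x*) ≤ (f(x₀) - f(x*) + (μ/2)‖x₀ - x*‖²)(1 - √(μ/L))^k`. -/
theorem nesterov_strongly_convex_rate
    {E : Type*} [NormedAddCommGroup E] [InnerProductSpace ℝ E] [FiniteDimensional ℝ E]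
    (f : E → ℝ) (hdiff : Differentiable ℝ f)
    (μ L : ℝ) (hμ : 0 < μ) (hμL : μ ≤ L)
    (hsc : ∀ x y : E, f y ≥ f x + ⟪gradient f x, y - x⟫ + μ / 2 * ‖y - x‖ ^ 2)
    (hlip : LipschitzWith (Real.toNNReal L) (gradient f))
    (xstar : E) (hmin : ∀ y : E, f xstar ≤ f y)
    (x y : ℕ → E) (hy0 : y 0 = x 0)
    (hx : ∀ k : ℕ, x (k + 1) = y k - (1 / L) • gradient f (y k))
    (hy : ∀ k : ℕ, y (k + 1) = x (k + 1)
        + ((Real.sqrt L - Real.sqrt μ) / (Real.sqrt L + Real.sqrt μ))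
            • (x (k + 1) - x k)) :
    ∀ k : ℕ, f (x k) - f xstar
      ≤ (f (x 0) - f xstar + μ / 2 * ‖x 0 - xstar‖ ^ 2)
          * (1 - Real.sqrt (μ / L)) ^ k := by
  have hL : 0 < L := lt_of_lt_of_le hμ hμL
  set q := Real.sqrt (μ / L) with hqdef
  have hq : 0 < q := Real.sqrt_pos.2 (div_pos hμ hL)
  have hq1 : q ≤ 1 := by
    rw [hqdef, Real.sqrt_le_iff, one_pow]
    exact ⟨zero_le_one, (div_le_one hL).2 hμL⟩
  have hqL : q ^ 2 * L = μ := by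
    rw [hqdef, Real.sq_sqrt (div_pos hμ hL).le]; field_simp
  have hβ : (Real.sqrt L - Real.sqrt μ) / (Real.sqrt L + Real.sqrt μ) = (1 - q) / (1 + q) := by
    have hsL : 0 < Real.sqrt L := Real.sqrt_pos.2 hL
    have hsμ : 0 < Real.sqrt μ := Real.sqrt_pos.2 hμ
    rw [hqdef, Real.sqrt_div hμ.le]
    field_simp
  rw [hβ] at hy
  have key : ∀ k : ℕ, f (x k) - f xstar
      + μ / 2 * ‖(y k - xstar) + (1 / q) • (y k - x k)‖ ^ 2
      ≤ (f (x 0) - f xstar + μ / 2 * ‖x 0 - xstar‖ ^ 2) * (1 - q) ^ k := by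
    intro k
    induction k with
    | zero => simp [hy0]
    | succ k ih =>
      have h1 : f (x (k + 1)) ≤ f (y k) - 1 / (2 * L) * ‖gradient f (y k)‖ ^ 2 := by
        have h := na_descent f hdiff L hL hlip (y k) (-((1 / L) • gradient f (y k)))
        rw [← sub_eq_add_neg, ← hx, inner_neg_right, inner_smul_right,
          real_inner_self_eq_norm_sq, norm_neg, norm_smul, mul_pow, Real.norm_eq_abs,
          sq_abs] at h
        refine h.trans (le_of_eq ?_)
        field_simp
        ring
      have h2 := hsc (y k) xstar
      have h3 := hsc (y k) (x k)
      rw [← neg_sub (y k) xstar, inner_neg_right, norm_neg] at h2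
      have h3' : f (x k) ≥ f (y k)
          - q * ⟪gradient f (y k), (1 / q) • (y k - x k)⟫ := by
        rw [inner_smul_right, ← mul_assoc, mul_one_div_cancel hq.ne', one_mul]
        rw [← neg_sub (y k) (x k), inner_neg_right] at h3
        have : 0 ≤ μ / 2 * ‖-(y k - x k)‖ ^ 2 := by positivity
        linarith
      have h := na_algebra μ L q hμ hL hq hq1 hqL (y k - xstar) ((1 / q) • (y k - x k))
        (gradient f (y k)) (f (x k)) (f (x (k + 1))) (f (y k)) (f xstar) h1 (by linarith) h3'
      have e : (y (k + 1) - xstar) + (1 / q) • (y (k + 1) - x (k + 1))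
          = (y k - xstar) + (1 - q) • ((1 / q) • (y k - x k))
            - (q / μ) • gradient f (y k) := by
        rw [hy, hx, ← hqL]
        have : 1 + q ≠ 0 := by positivity
        match_scalars <;> field_simp <;> ring
      rw [e]
      refine h.trans ?_
      rw [pow_succ (1 - q) k]
      have := mul_le_mul_of_nonneg_left ih (sub_nonneg.2 hq1)
      linarith
  intro k
  have h := key k
  have : 0 ≤ μ / 2 * ‖(y k - xstar) + (1 / q) • (y k - x k)‖ ^ 2 := by positivity
  linarith
end

section
/- Let f : E → ℝ be convex and differentiable with ∇f L-Lipschitz, and let x* be a minimizer of f. Define iterates by y₀ = x₀ and, for k ≥ 0, x_{k+1} = y_k - (1/L) ∇f(y_k), y_{k+1} = x_{k+1} + (k/(k + 3)) (x_{k+1} - x_k). Then for every k ≥ 1, f(x_k) - f(x*) ≤ (2L / (k + 1)²) ‖x₀ - x*‖². In particular Nesterov's method for smooth convex functions achieves the accelerated rate O(1/k²), improving on the O(1/k) rate of gradient descent. -/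
theorem nest_line {E : Type*} [NormedAddCommGroup E] [InnerProductSpace ℝ E]
    [FiniteDimensional ℝ E] (f : E → ℝ) (hdiff : Differentiable ℝ f) (y d : E) (t : ℝ) :
    HasDerivAt (fun s : ℝ => f (y + s • d)) (inner ℝ (gradient f (y + t • d)) d) t := by
  have h1 : HasDerivAt (fun s : ℝ => y + s • d) d t := by
    simpa using ((hasDerivAt_id t).smul_const d).const_add y
  have h2 := (hdiff (y + t • d)).hasFDerivAt.comp_hasDerivAt t h1
  rw [inner_gradient_left]
  exact h2

theorem nest_convex {E : Type*} [NormedAddCommGroup E] [InnerProductSpace ℝ E]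
    [FiniteDimensional ℝ E] (f : E → ℝ) (hconv : ConvexOn ℝ Set.univ f)
    (hdiff : Differentiable ℝ f) (y u : E) :
    f y ≤ f u + inner ℝ (gradient f y) (y - u) := by
  have hc : ConvexOn ℝ Set.univ (fun s : ℝ => f (y + s • (u - y))) := by
    have h := hconv.comp_affineMap (AffineMap.lineMap (k := ℝ) y u)
    rw [Set.preimage_univ] at h
    refine h.congr ?_
    intro s _
    simp [AffineMap.lineMap_apply, add_comm]
  have h := hc.le_slope_of_hasDerivAt (Set.mem_univ 0) (Set.mem_univ 1) one_pos
    (nest_line f hdiff y (u - y) 0)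
  simp only [slope_def_field, zero_smul, one_smul, add_zero, sub_zero, div_one,
    add_sub_cancel] at h
  rw [inner_sub_right] at h ⊢
  linarith

theorem nest_descent {E : Type*} [NormedAddCommGroup E] [InnerProductSpace ℝ E]
    [FiniteDimensional ℝ E] (f : E → ℝ) (hdiff : Differentiable ℝ f)
    (L : ℝ) (hL : 0 < L) (hlip : LipschitzWith (Real.toNNReal L) (gradient f)) (y d : E) :
    f (y + d) ≤ f y + inner ℝ (gradient f y) d + L / 2 * ‖d‖ ^ 2 := by
  have hB : ∀ t : ℝ, HasDerivAt
      (fun s : ℝ => f y + s * inner ℝ (gradient f y) d + L / 2 * ‖d‖ ^ 2 * s ^ 2)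
      (inner ℝ (gradient f y) d + L * ‖d‖ ^ 2 * t) t := by
    intro t
    have h := (((hasDerivAt_id t).mul_const (inner ℝ (gradient f y) d)).const_add (f y)).add
      (((hasDerivAt_id t).pow 2).const_mul (L / 2 * ‖d‖ ^ 2))
    refine h.congr_deriv ?_
    simp
    ring
  have hf := nest_line f hdiff y d
  have key := image_le_of_deriv_right_le_deriv_boundary (a := 0) (b := 1)
    (fun t _ => (hf t).continuousAt.continuousWithinAt)
    (fun t _ => (hf t).hasDerivWithinAt) (by simp)
    (fun t _ => (hB t).continuousAt.continuousWithinAt)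
    (fun t _ => (hB t).hasDerivWithinAt)
    (fun t ht => by
      have h1 : inner ℝ (gradient f (y + t • d)) d
          = inner ℝ (gradient f y) d + inner ℝ (gradient f (y + t • d) - gradient f y) d := by
        rw [inner_sub_left]; ring
      have h2 := real_inner_le_norm (gradient f (y + t • d) - gradient f y) d
      have h3 := hlip.norm_sub_le (y + t • d) y
      rw [add_sub_cancel_left, norm_smul, Real.norm_of_nonneg ht.1,
        Real.coe_toNNReal _ hL.le] at h3
      have h4 := mul_le_mul_of_nonneg_right h3 (norm_nonneg d)
      rw [h1]
      nlinarith) (Set.right_mem_Icc.2 zero_le_one)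
  simpa using key

theorem nest_step {E : Type*} [NormedAddCommGroup E] [InnerProductSpace ℝ E]
    [FiniteDimensional ℝ E] (f : E → ℝ) (hconv : ConvexOn ℝ Set.univ f)
    (hdiff : Differentiable ℝ f)
    (L : ℝ) (hL : 0 < L) (hlip : LipschitzWith (Real.toNNReal L) (gradient f))
    (s x y : E) (k : ℝ) (hk : 0 ≤ k) (z : E) (hz : z = ((k + 2) / 2) • y - (k / 2) • x) :
    (k + 2) ^ 2 / 4 * (f (y - (1 / L) • gradient f y) - f s)
      + L / 2 * ‖z - ((k + 2) / 2) • (1 / L) • gradient f y - s‖ ^ 2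
    ≤ k * (k + 2) / 4 * (f x - f s) + L / 2 * ‖z - s‖ ^ 2 := by
  have h1 := nest_descent f hdiff L hL hlip y (-((1 / L) • gradient f y))
  have h2 := nest_convex f hconv hdiff y x
  have h3 := nest_convex f hconv hdiff y s
  set g := gradient f y
  rw [← sub_eq_add_neg, inner_neg_right, norm_neg, norm_smul, inner_smul_right,
    real_inner_self_eq_norm_sq, Real.norm_of_nonneg (by positivity)] at h1
  have e1 : f y + -(1 / L * ‖g‖ ^ 2) + L / 2 * (1 / L * ‖g‖) ^ 2
      = f y - ‖g‖ ^ 2 / (2 * L) := by field_simp; ring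
  rw [e1] at h1
  have e2 : ‖z - ((k + 2) / 2) • (1 / L) • g - s‖ ^ 2
      = ‖z - s‖ ^ 2 - (k + 2) / L * inner ℝ g (z - s) + ((k + 2) / (2 * L)) ^ 2 * ‖g‖ ^ 2 := by
    have : z - ((k + 2) / 2) • (1 / L) • g - s = (z - s) - ((k + 2) / (2 * L)) • g := by
      rw [smul_smul, show (k + 2) / 2 * (1 / L) = (k + 2) / (2 * L) by field_simp]; abel
    rw [this, norm_sub_sq_real, inner_smul_right, norm_smul, mul_pow, Real.norm_eq_abs, sq_abs,
      real_inner_comm]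
    field_simp
  have e3 : inner ℝ g (z - s) = k / 2 * inner ℝ g (y - x) + inner ℝ g (y - s) := by
    rw [hz]
    simp only [inner_sub_right, inner_smul_right]
    ring
  have e4 : L / 2 * ‖z - ((k + 2) / 2) • (1 / L) • g - s‖ ^ 2 = L / 2 * ‖z - s‖ ^ 2
      - (k + 2) / 2 * inner ℝ g (z - s) + (k + 2) ^ 2 / 4 * (‖g‖ ^ 2 / (2 * L)) := by
    rw [e2]; field_simp; ring
  rw [e4, e3]
  have m1 := mul_le_mul_of_nonneg_left h1 (show 0 ≤ (k + 2) ^ 2 / 4 by positivity)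
  have m2 := mul_le_mul_of_nonneg_left h2 (show 0 ≤ k * (k + 2) / 4 by positivity)
  have m3 := mul_le_mul_of_nonneg_left h3 (show 0 ≤ (k + 2) / 2 by positivity)
  linarith

/-- Nesterov's accelerated method for smooth convex `f`
(`x_{k+1} = y_k - (1/L)∇f(y_k)`, `y_{k+1} = x_{k+1} + (k/(k+3))(x_{k+1} - x_k)`,
`y₀ = x₀`) achieves `f(x_k) - f(x*) ≤ (2L/(k+1)²)‖x₀ - x*‖²` for all `k ≥ 1`. -/
theorem nesterov_convex_rate
    {E : Type*} [NormedAddCommGroup E] [InnerProductSpace ℝ E] [FiniteDimensional ℝ E]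
    (f : E → ℝ) (hconv : ConvexOn ℝ Set.univ f) (hdiff : Differentiable ℝ f)
    (L : ℝ) (hL : 0 < L)
    (hlip : LipschitzWith (Real.toNNReal L) (gradient f))
    (xstar : E) (hmin : ∀ z : E, f xstar ≤ f z)
    (x y : ℕ → E) (hy0 : y 0 = x 0)
    (hx : ∀ k : ℕ, x (k + 1) = y k - (1 / L) • gradient f (y k))
    (hy : ∀ k : ℕ, y (k + 1) = x (k + 1)
        + ((k : ℝ) / ((k : ℝ) + 3)) • (x (k + 1) - x k)) :
    ∀ k : ℕ, 1 ≤ k →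
      f (x k) - f xstar ≤ 2 * L / ((k : ℝ) + 1) ^ 2 * ‖x 0 - xstar‖ ^ 2 := by
  have zrec : ∀ k : ℕ, ((((k + 1 : ℕ) : ℝ) + 2) / 2) • y (k + 1) - (((k + 1 : ℕ) : ℝ) / 2) • x (k + 1)
      = ((((k : ℝ) + 2) / 2) • y k - ((k : ℝ) / 2) • x k)
        - (((k : ℝ) + 2) / 2) • (1 / L) • gradient f (y k) := by
    intro k
    have hk : (k : ℝ) + 3 ≠ 0 := by positivity
    have e : (1 / L) • gradient f (y k) = y k - x (k + 1) := by rw [hx k]; abel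
    rw [e, hy k]
    push_cast
    match_scalars <;> field_simp <;> ring
  have step := fun k : ℕ => nest_step f hconv hdiff L hL hlip xstar (x k) (y k) k
    (Nat.cast_nonneg k) _ rfl
  simp only [← zrec, ← hx] at step
  have inv : ∀ k : ℕ, (k : ℝ) * (k + 2) / 4 * (f (x k) - f xstar)
      + L / 2 * ‖(((k : ℝ) + 2) / 2) • y k - ((k : ℝ) / 2) • x k - xstar‖ ^ 2
      ≤ L / 2 * ‖x 0 - xstar‖ ^ 2 := by
    intro k
    induction k with
    | zero => simp [hy0]
    | succ k ih =>
      have h := (step k).trans ih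
      refine le_trans ?_ h
      have := hmin (x (k + 1))
      have hc : ((k + 1 : ℕ) : ℝ) * (((k + 1 : ℕ) : ℝ) + 2) / 4 ≤ ((k : ℝ) + 2) ^ 2 / 4 := by
        push_cast; nlinarith
      exact add_le_add_left (mul_le_mul_of_nonneg_right hc (sub_nonneg.2 this)) _
  intro k hk
  obtain ⟨k, rfl⟩ := Nat.exists_eq_add_of_le' hk
  have h := (step k).trans (inv k)
  have h' : ((k : ℝ) + 2) ^ 2 / 4 * (f (x (k + 1)) - f xstar) ≤ L / 2 * ‖x 0 - xstar‖ ^ 2 :=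
    le_trans (le_add_of_nonneg_right (by positivity)) h
  push_cast
  rw [show (k : ℝ) + 1 + 1 = k + 2 by ring, div_mul_eq_mul_div, le_div_iff₀ (by positivity)]
  linarith
end
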